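/- Let p be a prime. Let A ⊆ B be Noetherian integrally closed domains of characteristic p such that B is a finitely generated A-module, and let K = Frac(A) and L = Frac(B), so that L/K is a finite field extension; assume [L : K] < p. Let φ : L → L be a function satisfying φ(a+b) = φ(a)+φ(b), φ(aᵖ·b) = a·φ(b) for all a, b ∈ L, and φ(1) = 1, such that φ(B) ⊆ B and φ(A) ⊆ A. Let 𝔭 be a prime ideal of A with φ(𝔭) ⊆ 𝔭. Then the radical J = √(𝔭B) of the ideal of B generated by 𝔭 satisfies φ(J) ⊆ J. -/

import Mathlib

open Polynomial in
theorem eq_zero_of_sum_pow_eq_zero {R ι : Type*} [CommRing R] [IsDomain R] (p : ℕ) [CharP R p]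
    [Fintype ι] (hcard : Fintype.card ι < p) (s : ι → R)
    (hs : ∀ k, 1 ≤ k → ∑ i, s i ^ k = 0) (i : ι) : s i = 0 := by
  classical
  by_contra hi
  have key (g : R[X]) : ∑ j, s j * g.eval (s j) = 0 := by
    induction g using Polynomial.induction_on' with
    | add f g hf hg => simp only [eval_add, mul_add, Finset.sum_add_distrib, hf, hg, add_zero]
    | monomial n a =>
      have := hs (n + 1) (by omega)
      calc ∑ j, s j * (monomial n a).eval (s j) = a * ∑ j, s j ^ (n + 1) := by
            rw [Finset.mul_sum]
            exact Finset.sum_congr rfl fun j _ ↦ by rw [eval_monomial]; ring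
        _ = 0 := by rw [this, mul_zero]
  set g : R[X] := ∏ w ∈ (Finset.univ.image s).erase (s i), (X - C w) with hg
  have hg0 : g.eval (s i) ≠ 0 := by
    rw [hg, eval_prod, Finset.prod_ne_zero_iff]
    intro w hw
    simpa [sub_ne_zero] using (Finset.ne_of_mem_erase hw).symm
  have hg1 (j : ι) (hj : s j ≠ s i) : g.eval (s j) = 0 := by
    rw [hg, eval_prod]
    exact Finset.prod_eq_zero (Finset.mem_erase.2 ⟨hj, by simp⟩) (by simp)
  have hsum : ∑ j, s j * g.eval (s j) =
      (({j | s j = s i} : Finset ι).card : R) * (s i * g.eval (s i)) := by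
    rw [← nsmul_eq_mul, ← Finset.sum_const, Finset.sum_filter]
    refine Finset.sum_congr rfl fun j _ ↦ ?_
    split_ifs with h
    · rw [h]
    · rw [hg1 j h, mul_zero]
  rw [key g, eq_comm] at hsum
  have hm := (mul_eq_zero.1 hsum).resolve_right (mul_ne_zero hi hg0)
  rw [CharP.cast_eq_zero_iff R p] at hm
  have hpos : 0 < ({j | s j = s i} : Finset ι).card := Finset.card_pos.2 ⟨i, by simp⟩
  exact absurd (Nat.le_of_dvd hpos hm) (not_le.2 ((Finset.card_le_univ _).trans_lt hcard))

theorem Algebra.isSeparable_of_finrank_lt_char (K L : Type*) [Field K] [Field L] [Algebra K L]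
    [FiniteDimensional K L] (p : ℕ) [CharP K p] (h : Module.finrank K L < p) :
    Algebra.IsSeparable K L := by
  refine ⟨fun x ↦ ?_⟩
  have hx : IsIntegral K x := Algebra.IsIntegral.isIntegral x
  refine (Polynomial.separable_iff_derivative_ne_zero (minpoly.irreducible hx)).2 fun h0 ↦ ?_
  have hpos := minpoly.natDegree_pos hx
  have hc := congrArg (fun f ↦ f.coeff ((minpoly K x).natDegree - 1)) h0
  simp only [Polynomial.coeff_derivative, Polynomial.coeff_zero] at hc
  rw [Nat.sub_add_cancel hpos, Polynomial.coeff_natDegree, (minpoly.monic hx).leadingCoeff,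
    one_mul, ← Nat.cast_succ, Nat.succ_eq_add_one, Nat.sub_add_cancel hpos,
    CharP.cast_eq_zero_iff K p] at hc
  exact absurd (Nat.le_of_dvd hpos hc) (not_le.2 ((minpoly.natDegree_le x).trans_lt h))

theorem FiniteDimensional.of_isFractionRing (A B K L : Type*) [CommRing A] [CommRing B]
    [IsDomain A] [IsDomain B] [IsIntegrallyClosed B] [Field K] [Field L]
    [Algebra A K] [IsFractionRing A K] [Algebra B L] [IsFractionRing B L]
    [Algebra A B] (hinj : Function.Injective (algebraMap A B)) [Module.Finite A B]
    [Algebra K L] [Algebra A L] [IsScalarTower A B L] [IsScalarTower A K L] :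
    FiniteDimensional K L := by
  have : Module.IsTorsionFree A B := by
    rwa [Module.isTorsionFree_iff_algebraMap_injective]
  have : IsIntegralClosure B A L := IsIntegralClosure.of_isIntegrallyClosed _ _ _
  have : Algebra.IsAlgebraic K L := isAlgebraic_of_isFractionRing A B ..
  have : IsLocalization (Algebra.algebraMapSubmonoid B (nonZeroDivisors A)) L :=
    IsIntegralClosure.isLocalization A K L B
  exact .of_isLocalization A B (nonZeroDivisors A)

/-- The trace of a separable extension commutes with the Frobenius. -/
theorem Algebra.trace_pow_char (K L : Type*) [Field K] [Field L] [Algebra K L]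
    [FiniteDimensional K L] [Algebra.IsSeparable K L] (p : ℕ) [Fact p.Prime] [CharP K p] (x : L) :
    Algebra.trace K L (x ^ p) = Algebra.trace K L x ^ p := by
  have : CharP (AlgebraicClosure L) p := charP_of_injective_algebraMap
    (FaithfulSMul.algebraMap_injective K (AlgebraicClosure L)) p
  apply FaithfulSMul.algebraMap_injective K (AlgebraicClosure L)
  rw [(algebraMap K (AlgebraicClosure L)).map_pow, trace_eq_sum_embeddings,
    trace_eq_sum_embeddings, sum_pow_char]
  simp

/-- A `p⁻¹`-linear map on a separable extension `L / K` preserving `K` commutes with the trace. -/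
theorem Algebra.algebraMap_trace_frobenius_inverse_linear {K L : Type*} [Field K] [Field L]
    [Algebra K L] [FiniteDimensional K L] [Algebra.IsSeparable K L] {p : ℕ} [Fact p.Prime]
    [CharP K p] {φ : L → L} (hadd : ∀ x y : L, φ (x + y) = φ x + φ y)
    (hmul : ∀ x y : L, φ (x ^ p * y) = x * φ y)
    (hK : ∀ x : K, ∃ y : K, φ (algebraMap K L x) = algebraMap K L y) (x : L) :
    algebraMap K L (Algebra.trace K L (φ x)) = φ (algebraMap K L (Algebra.trace K L x)) := by
  have : ExpChar K p := .prime Fact.out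
  have h0 : φ 0 = 0 := by simpa using hadd 0 0
  have hspan : x ∈ Submodule.span K (Set.range fun y : L ↦ y ^ p) := by
    have := Field.span_map_pow_expChar_pow_eq_top_of_isSeparable (F := K) (E := L) p 1
      (v := (_root_.id : L → L)) (by simp)
    simp only [_root_.id, pow_one] at this
    rw [this]
    trivial
  induction hspan using Submodule.closure_induction with
  | zero => simp [h0]
  | add x y _ _ hx hy => simp only [hadd, map_add, hx, hy]
  | smul_mem k y hy =>
    obtain ⟨y, rfl⟩ := hy
    obtain ⟨k', hk'⟩ := hK k
    have h1 : φ (k • y ^ p) = k' • y := by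
      rw [Algebra.smul_def, mul_comm, hmul, hk', Algebra.smul_def, mul_comm]
    simp only [h1, map_smul, Algebra.trace_pow_char K L p y, smul_eq_mul, map_mul, map_pow]
    rw [mul_comm _ (_ ^ p), hmul, hk', mul_comm]

section Embeddings

variable {A B K L : Type*} [CommRing A] [CommRing B] [Field K] [Field L] [Algebra A K]
  [Algebra B L] [Algebra A B] [Algebra.IsIntegral A B] [Algebra K L] [Algebra A L]
  [IsScalarTower A B L] [IsScalarTower A K L]
  {Ω : Type*} [Field Ω] [Algebra K Ω] [Algebra A Ω] [IsScalarTower A K Ω]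

/-- An embedding of `L` restricted to a map from an integral extension of `A` in `L` to the
integral closure of `A`. -/
def AlgHom.restrictIntegralClosure (B : Type*) [CommRing B] [Algebra B L] [Algebra A B]
    [Algebra.IsIntegral A B] [IsScalarTower A B L] (σ : L →ₐ[K] Ω) :
    B →ₐ[A] integralClosure A Ω :=
  AlgHom.codRestrict ((σ.restrictScalars A).comp (IsScalarTower.toAlgHom A B L))
    (integralClosure A Ω) fun b ↦ (Algebra.IsIntegral.isIntegral (R := A) b).map _

theorem AlgHom.coe_restrictIntegralClosure (σ : L →ₐ[K] Ω) (b : B) :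
    (σ.restrictIntegralClosure (A := A) B b : Ω) = σ (algebraMap B L b) := rfl

variable [IsAlgClosed Ω] [FiniteDimensional K L] [Algebra.IsSeparable K L]

theorem algebraMap_eq_sum_restrictIntegralClosure {b : B} {a : A}
    (h : Algebra.trace K L (algebraMap B L b) = algebraMap A K a) :
    algebraMap A (integralClosure A Ω) a =
      ∑ σ : L →ₐ[K] Ω, σ.restrictIntegralClosure (A := A) B b := by
  apply Subtype.val_injective
  have := trace_eq_sum_embeddings Ω (K := K) (x := algebraMap B L b)
  rw [h, ← IsScalarTower.algebraMap_apply] at this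
  rw [AddSubmonoidClass.coe_finsetSum]
  exact this

end Embeddings

section Trace

variable {A B K L : Type*} [CommRing A] [CommRing B] [Field K] [Field L]
  [Algebra A K] [Algebra B L] [Algebra A B] [Algebra.IsIntegral A B]
  [Algebra K L] [Algebra A L] [IsScalarTower A B L] [IsScalarTower A K L]
  [FiniteDimensional K L] [Algebra.IsSeparable K L]

theorem exists_mem_trace_eq_of_mem_radical_map [IsIntegrallyClosed A] [IsFractionRing A K]
    {𝔭 : Ideal A} [h𝔭 : 𝔭.IsPrime] {b : B}
    (hb : b ∈ (𝔭.map (algebraMap A B)).radical) :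
    ∃ a ∈ 𝔭, Algebra.trace K L (algebraMap B L b) = algebraMap A K a := by
  have hint : IsIntegral A (Algebra.trace K L (algebraMap B L b)) :=
    Algebra.isIntegral_trace ((Algebra.IsIntegral.isIntegral (R := A) b).algebraMap)
  obtain ⟨a, ha⟩ := IsIntegrallyClosed.isIntegral_iff.1 hint
  refine ⟨a, ?_, ha.symm⟩
  let S := integralClosure A (AlgebraicClosure L)
  have hinjS : Function.Injective (algebraMap A S) := by
    refine Function.Injective.of_comp (f := algebraMap S (AlgebraicClosure L)) ?_
    rw [← RingHom.coe_comp, ← IsScalarTower.algebraMap_eq,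
      IsScalarTower.algebraMap_eq A K, RingHom.coe_comp]
    exact (algebraMap K _).injective.comp (IsFractionRing.injective A K)
  obtain ⟨Q, hQ, hQ𝔭⟩ := Ideal.exists_ideal_over_prime_of_isIntegral_of_isDomain (S := S) 𝔭
    (((RingHom.injective_iff_ker_eq_bot _).1 hinjS).trans_le bot_le)
  rw [← hQ𝔭, Ideal.mem_comap, algebraMap_eq_sum_restrictIntegralClosure ha.symm]
  refine Q.sum_mem fun σ _ ↦ ?_
  have hle : (𝔭.map (algebraMap A B)).radical ≤
      Q.comap (σ.restrictIntegralClosure (A := A) B) := by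
    refine (Ideal.IsPrime.radical_le_iff (Ideal.comap_isPrime _ _)).2
      (Ideal.map_le_iff_le_comap.2 ?_)
    intro x hx
    rw [← hQ𝔭] at hx
    simpa using hx
  exact hle hb

theorem mem_radical_map_of_trace_pow_mem [IsDomain B] [IsFractionRing B L]
    {p : ℕ} [CharP K p] (hp : p.Prime)
    (hdeg : Module.finrank K L < p) {𝔭 : Ideal A} {b : B}
    (hb : ∀ k, 1 ≤ k → ∃ a ∈ 𝔭, Algebra.trace K L (algebraMap B L b ^ k) = algebraMap A K a) :
    b ∈ (𝔭.map (algebraMap A B)).radical := by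
  rw [Ideal.radical_eq_sInf, Ideal.mem_sInf]
  rintro q ⟨h𝔭q, hq⟩
  let S := integralClosure A (AlgebraicClosure L)
  let τ : L →ₐ[K] AlgebraicClosure L := IsScalarTower.toAlgHom K L _
  let f : B →ₐ[A] S := τ.restrictIntegralClosure B
  have hf : Function.Injective f := by
    intro x y hxy
    exact IsFractionRing.injective B L (τ.injective (congrArg Subtype.val hxy))
  algebraize [f.toRingHom]
  have : IsScalarTower A B S := .of_algebraMap_eq fun x ↦ (f.commutes x).symm
  have : Algebra.IsIntegral B S := .tower_top (R := A)
  obtain ⟨Q, hQ, hQq⟩ := Ideal.exists_ideal_over_prime_of_isIntegral_of_isDomain (S := S) q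
    (((RingHom.injective_iff_ker_eq_bot (algebraMap B S)).1 hf).trans_le bot_le)
  have hQA : 𝔭 ≤ Q.comap (algebraMap A S) := by
    rw [IsScalarTower.algebraMap_eq A B S, ← Ideal.comap_comap, hQq]
    exact Ideal.map_le_iff_le_comap.1 h𝔭q
  have : CharP (S ⧸ Q) p := by
    have : CharP (AlgebraicClosure L) p := charP_of_injective_algebraMap
      (FaithfulSMul.algebraMap_injective K (AlgebraicClosure L)) p
    have h0 : ((p : ℕ) : S) = 0 := Subtype.val_injective (by simp)
    have h0 : ((p : ℕ) : S ⧸ Q) = 0 := by simpa using congrArg (Ideal.Quotient.mk Q) h0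
    exact ringChar.of_eq (CharP.ringChar_of_prime_eq_zero hp h0)
  have hz := eq_zero_of_sum_pow_eq_zero p (by rwa [AlgHom.card K L])
    (fun σ : L →ₐ[K] AlgebraicClosure L ↦
      Ideal.Quotient.mk Q (σ.restrictIntegralClosure (A := A) B b)) (fun k hk ↦ by
        obtain ⟨a, ha, hak⟩ := hb k hk
        rw [← map_pow] at hak
        have h1 := algebraMap_eq_sum_restrictIntegralClosure (Ω := AlgebraicClosure L) hak
        have h2 : algebraMap A S a ∈ Q := hQA ha
        rw [h1, ← Ideal.Quotient.eq_zero_iff_mem] at h2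
        simpa using h2) τ
  rw [← hQq, Ideal.mem_comap]
  exact Ideal.Quotient.eq_zero_iff_mem.1 hz

end Trace


/-- Central Proposition, ring-theoretic form. Let `p` be a prime, `A ⊆ B` Noetherian
integrally closed domains of characteristic `p` with `B` a finitely generated `A`-module,
`K = Frac(A)`, `L = Frac(B)`, and `[L : K] < p`. Let `φ : L → L` be a Frobenius splitting
with `φ(B) ⊆ B` and `φ(A) ⊆ A`, and let `𝔭` be a prime ideal of `A` with `φ(𝔭) ⊆ 𝔭`.
Then `J = √(𝔭B)` satisfies `φ(J) ⊆ J`. -/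
theorem radical_preimage_compatibly_split (p : ℕ) (hp : p.Prime)
    (A B K L : Type) [CommRing A] [CommRing B] [IsDomain A] [IsDomain B]
    [IsNoetherianRing A] [IsNoetherianRing B]
    [IsIntegrallyClosed A] [IsIntegrallyClosed B] [CharP A p] [CharP B p]
    [Field K] [Field L] [Algebra A K] [IsFractionRing A K]
    [Algebra B L] [IsFractionRing B L]
    [Algebra A B] (hinj : Function.Injective (algebraMap A B)) [Module.Finite A B]
    [Algebra K L] [Algebra A L] [IsScalarTower A B L] [IsScalarTower A K L]
    (hdeg : Module.finrank K L < p)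
    (φ : L → L)
    (hadd : ∀ x y : L, φ (x + y) = φ x + φ y)
    (hmul : ∀ x y : L, φ (x ^ p * y) = x * φ y)
    (hone : φ 1 = 1)
    (hB : ∀ b : B, ∃ b' : B, φ (algebraMap B L b) = algebraMap B L b')
    (hA : ∀ a : A, ∃ a' : A, φ (algebraMap A L a) = algebraMap A L a')
    (𝔭 : Ideal A) (h𝔭 : 𝔭.IsPrime)
    (hsplit : ∀ a ∈ 𝔭, φ (algebraMap A L a) ∈ algebraMap A L '' (𝔭 : Set A)) :
    ∀ b ∈ (𝔭.map (algebraMap A B)).radical,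
      φ (algebraMap B L b) ∈
        algebraMap B L '' ((𝔭.map (algebraMap A B)).radical : Set B) := by
  have : Fact p.Prime := ⟨hp⟩
  have : FiniteDimensional K L := .of_isFractionRing A B K L hinj
  have : CharP K p := charP_of_injective_algebraMap (IsFractionRing.injective A K) p
  have : Algebra.IsSeparable K L := Algebra.isSeparable_of_finrank_lt_char K L p hdeg
  have hK (x : K) : ∃ y : K, φ (algebraMap K L x) = algebraMap K L y := by
    obtain ⟨a, s, hs, rfl⟩ := IsFractionRing.div_surjective (A := A) x
    have hs0 : algebraMap A K s ≠ 0 := IsFractionRing.to_map_ne_zero_of_mem_nonZeroDivisors hs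
    obtain ⟨c, hc⟩ := hA (s ^ (p - 1) * a)
    refine ⟨algebraMap A K c / algebraMap A K s, ?_⟩
    have hx : algebraMap A K a / algebraMap A K s =
        (algebraMap A K s)⁻¹ ^ p * algebraMap A K (s ^ (p - 1) * a) := by
      obtain ⟨n, rfl⟩ : ∃ n, p = n + 1 := ⟨p - 1, (Nat.sub_add_cancel hp.one_le).symm⟩
      simp only [Nat.add_sub_cancel, map_mul, map_pow]
      rw [inv_pow, pow_succ]
      field_simp
    rw [hx, map_mul, map_pow, hmul, ← IsScalarTower.algebraMap_apply, hc,
      IsScalarTower.algebraMap_apply A K L, ← map_mul, div_eq_inv_mul]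
  intro b hb
  obtain ⟨c, hc⟩ := hB b
  refine ⟨c, mem_radical_map_of_trace_pow_mem (K := K) (L := L) hp hdeg fun k hk ↦ ?_, hc.symm⟩
  obtain ⟨a, ha, hab⟩ := exists_mem_trace_eq_of_mem_radical_map (K := K) (L := L)
    (Ideal.mul_mem_left _ ((c ^ (k - 1)) ^ p) hb)
  obtain ⟨a', ha', haa'⟩ := hsplit a ha
  refine ⟨a', ha', (algebraMap K L).injective ?_⟩
  rw [← IsScalarTower.algebraMap_apply, haa', IsScalarTower.algebraMap_apply A K L, ← hab,
    ← Algebra.algebraMap_trace_frobenius_inverse_linear hadd hmul hK,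
    (algebraMap B L).map_mul, (algebraMap B L).map_pow, hmul, hc, (algebraMap B L).map_pow,
    ← pow_succ, Nat.sub_add_cancel hk]
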